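/- arXiv:1701.05793 — 8 statements merged into one kernel-verified Lean document; each statement's English description precedes it below -/
import Mathlib

section
/- Let A > 0, let μ : [0,A] → ℝ be continuous and nonnegative, let D* ∈ ℝ, and let x* : [0,A] → ℝ be positive and differentiable with x*'(a) = −(μ(a)+D*)x*(a). Let y_ref : [0,∞) → (0,∞) be continuously differentiable, let D : [0,∞) → ℝ, let ψ : [−A,∞) → ℝ, and let η : [0,∞) → ℝ be differentiable with η'(t) = D* − y_ref'(t)/y_ref(t) − D(t) for all t ≥ 0. Define Φ_x(a,t) := x*(a) · y_ref(t) · e^{η(t)} · (1 + ψ(t−a)). Then at every point (a,t) ∈ (0,A) × (0,∞) at which ψ is differentiable at t−a, the partial derivatives of Φ_x exist and satisfy the transport PDE ∂Φ_x/∂t (a,t) + ∂Φ_x/∂a (a,t) = −(μ(a) + D(t)) Φ_x(a,t). -/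
/-- The parameterization `Φ_x(a,t) = x*(a)·y_ref(t)·e^{η(t)}·(1+ψ(t−a))` satisfies the
transport PDE `∂_t Φ_x + ∂_a Φ_x = −(μ(a)+D(t))·Φ_x` at every interior point where `ψ`
is differentiable at `t−a`. -/
theorem parameterization_satisfies_transport_pde
    (A : ℝ) (hA : 0 < A)
    (μ : ℝ → ℝ)
    (hμc : ContinuousOn μ (Set.Icc 0 A)) (hμ0 : ∀ a ∈ Set.Icc 0 A, 0 ≤ μ a)
    (Dstar : ℝ)
    (xs : ℝ → ℝ) (hxspos : ∀ a ∈ Set.Icc 0 A, 0 < xs a)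
    (hxsd : ∀ a ∈ Set.Icc 0 A, HasDerivWithinAt xs (-(μ a + Dstar) * xs a) (Set.Icc 0 A) a)
    (yref : ℝ → ℝ) (hypos : ∀ t, 0 ≤ t → 0 < yref t)
    (hyd : ∀ t, 0 ≤ t → DifferentiableAt ℝ yref t)
    (hydc : ContinuousOn (deriv yref) (Set.Ici 0))
    (D ψ η : ℝ → ℝ)
    (hη : ∀ t, 0 ≤ t → HasDerivAt η (Dstar - deriv yref t / yref t - D t) t)
    (Φ : ℝ → ℝ → ℝ)
    (hΦ : ∀ a t, Φ a t = xs a * yref t * Real.exp (η t) * (1 + ψ (t - a)))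
    (a t : ℝ) (ha : a ∈ Set.Ioo 0 A) (ht : 0 < t)
    (hψd : DifferentiableAt ℝ ψ (t - a)) :
    ∃ Φt Φa : ℝ,
      HasDerivAt (fun τ => Φ a τ) Φt t ∧
      HasDerivAt (fun s => Φ s t) Φa a ∧
      Φt + Φa = -(μ a + D t) * Φ a t := by
  have hx : HasDerivAt xs (-(μ a + Dstar) * xs a) a :=
    (hxsd a ⟨ha.1.le, ha.2.le⟩).hasDerivAt (Icc_mem_nhds ha.1 ha.2)
  have hy := (hyd t ht.le).hasDerivAt
  have he := (hη t ht.le).exp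
  have hp1 : HasDerivAt (fun τ => 1 + ψ (τ - a)) (deriv ψ (t - a)) t :=
    (hψd.hasDerivAt.comp_sub_const t a).const_add 1
  have hp2 : HasDerivAt (fun s => 1 + ψ (t - s)) (-deriv ψ (t - a)) a :=
    (hψd.hasDerivAt.comp_const_sub t a).const_add 1
  have hy0 : yref t ≠ 0 := (hypos t ht.le).ne'
  simp only [hΦ]
  refine ⟨_, _, ((hy.const_mul (xs a)).mul he).mul hp1,
    ((hx.mul_const (yref t)).mul_const (Real.exp (η t))).mul hp2, ?_⟩
  simp only [Pi.mul_apply]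
  field_simp
  ring
end

section
/- Let A > 0, σ ≥ 0, let g : [0,A] → ℝ be continuous and nonnegative with ∫₀^A g(a) da = 1, and let ψ : [0,A] → ℝ be continuous with ψ(a) > −1 for all a ∈ [0,A]. Then 1 + ∫₀^A g(a)ψ(a) da > 0 and |ln(1 + ∫₀^A g(a)ψ(a) da)| ≤ e^{σA} · max_{a∈[0,A]} |e^{−σa} ψ(a)| / (1 + min(0, min_{a∈[0,A]} ψ(a))). -/
/-- Bound on the logarithmic output error `δ = ln(1 + ∫₀^A g ψ)` in terms of the
weighted sup norm of `ψ`. -/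
theorem delta_bound
    (A σ : ℝ) (hA : 0 < A) (hσ : 0 ≤ σ)
    (g ψ : ℝ → ℝ)
    (hgc : ContinuousOn g (Set.Icc 0 A)) (hg0 : ∀ a ∈ Set.Icc 0 A, 0 ≤ g a)
    (hgint : ∫ a in (0:ℝ)..A, g a = 1)
    (hψc : ContinuousOn ψ (Set.Icc 0 A))
    (hψ : ∀ a ∈ Set.Icc 0 A, -1 < ψ a) :
    0 < 1 + ∫ a in (0:ℝ)..A, g a * ψ a ∧
    |Real.log (1 + ∫ a in (0:ℝ)..A, g a * ψ a)| ≤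
      Real.exp (σ * A) *
        sSup ((fun a => |Real.exp (-σ * a) * ψ a|) '' Set.Icc 0 A) /
        (1 + min 0 (sInf (ψ '' Set.Icc 0 A))) := by
  have hne : (Set.Icc 0 A).Nonempty := ⟨0, le_refl _, hA.le⟩
  have hu : Set.uIcc 0 A = Set.Icc 0 A := Set.uIcc_of_le hA.le
  have hwc : ContinuousOn (fun a => |Real.exp (-σ * a) * ψ a|) (Set.Icc 0 A) := by
    refine ContinuousOn.abs (ContinuousOn.mul ?_ hψc)
    fun_prop
  have hSle : ∀ a ∈ Set.Icc 0 A, |Real.exp (-σ * a) * ψ a| ≤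
      sSup ((fun a => |Real.exp (-σ * a) * ψ a|) '' Set.Icc 0 A) := fun a ha =>
    le_csSup (isCompact_Icc.image_of_continuousOn hwc).bddAbove (Set.mem_image_of_mem _ ha)
  have hmle : ∀ a ∈ Set.Icc 0 A, sInf (ψ '' Set.Icc 0 A) ≤ ψ a := fun a ha =>
    csInf_le (isCompact_Icc.image_of_continuousOn hψc).bddBelow (Set.mem_image_of_mem _ ha)
  have hm1 : -1 < sInf (ψ '' Set.Icc 0 A) := by
    obtain ⟨a, ha, h⟩ := (isCompact_Icc.image_of_continuousOn hψc).sInf_mem (hne.image ψ)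
    rw [← h]
    exact hψ a ha
  generalize sSup ((fun a => |Real.exp (-σ * a) * ψ a|) '' Set.Icc 0 A) = S at *
  generalize sInf (ψ '' Set.Icc 0 A) = m at *
  have hbd : ∀ a ∈ Set.Icc 0 A, |ψ a| ≤ Real.exp (σ * A) * S := by
    intro a ha
    have h1 := hSle a ha
    have h2 : |ψ a| = Real.exp (σ * a) * |Real.exp (-σ * a) * ψ a| := by
      rw [abs_mul, Real.abs_exp, ← mul_assoc, ← Real.exp_add]
      simp
    rw [h2]
    have h3 : Real.exp (σ * a) ≤ Real.exp (σ * A) :=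
      Real.exp_le_exp.2 (mul_le_mul_of_nonneg_left ha.2 hσ)
    exact mul_le_mul h3 h1 (abs_nonneg _) (Real.exp_pos _).le
  generalize Real.exp (σ * A) * S = M at *
  have hgi : IntervalIntegrable g MeasureTheory.volume 0 A :=
    ContinuousOn.intervalIntegrable (by rwa [hu])
  have hgψi : IntervalIntegrable (fun a => g a * ψ a) MeasureTheory.volume 0 A :=
    ContinuousOn.intervalIntegrable (by rw [hu]; exact hgc.mul hψc)
  have hc : ∀ c : ℝ, ∫ a in (0:ℝ)..A, g a * c = c := by
    intro c
    rw [intervalIntegral.integral_mul_const, hgint, one_mul]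
  have low : ∀ c : ℝ, (∀ a ∈ Set.Icc 0 A, c ≤ ψ a) → c ≤ ∫ a in (0:ℝ)..A, g a * ψ a := by
    intro c h
    calc c = ∫ a in (0:ℝ)..A, g a * c := (hc c).symm
      _ ≤ _ := intervalIntegral.integral_mono_on hA.le (hgi.mul_const c) hgψi
        fun a ha => mul_le_mul_of_nonneg_left (h a ha) (hg0 a ha)
  have hI1 := low m hmle
  have hI2 := low (-M) fun a ha => (abs_le.1 (hbd a ha)).1
  have hI3 : ∫ a in (0:ℝ)..A, g a * ψ a ≤ M := by
    calc _ ≤ ∫ a in (0:ℝ)..A, g a * M :=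
        intervalIntegral.integral_mono_on hA.le hgψi (hgi.mul_const M)
          fun a ha => mul_le_mul_of_nonneg_left (abs_le.1 (hbd a ha)).2 (hg0 a ha)
      _ = M := hc M
  have hM : 0 ≤ M := (abs_nonneg _).trans (hbd 0 ⟨le_refl _, hA.le⟩)
  generalize ∫ a in (0:ℝ)..A, g a * ψ a = I at *
  have hpos : 0 < 1 + I := by linarith
  have hD0 : 0 < 1 + min 0 m := by
    have : -1 < min 0 m := lt_min (by norm_num) hm1
    linarith
  have hD1 : 1 + min 0 m ≤ 1 := by linarith [min_le_left 0 m]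
  have hD2 : 1 + min 0 m ≤ 1 + I := by linarith [min_le_right 0 m]
  refine ⟨hpos, abs_le.2 ⟨?_, ?_⟩⟩
  · have h1 := Real.one_sub_inv_le_log_of_pos hpos
    have h2 : 1 - (1 + I)⁻¹ = -((-I) / (1 + I)) := by field_simp; ring
    have h3 : (-I) / (1 + I) ≤ M / (1 + I) :=
      div_le_div_of_nonneg_right (by linarith) hpos.le
    have h4 : M / (1 + I) ≤ M / (1 + min 0 m) := div_le_div_of_nonneg_left hM hD0 hD2
    linarith
  · have h1 := Real.log_le_sub_one_of_pos hpos
    have h2 : M ≤ M / (1 + min 0 m) := le_div_self hM hD0 hD1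
    linarith
end

section
/- Let l₁, l₂, p₁, p₂ > 0 satisfy (2 + l₁p₁ − 2l₂p₂)² < 8l₁p₁ − 4l₂p₁² and p₁² < 4p₂. Then the symmetric 2×2 real matrices P = [[1, −p₁/2], [−p₁/2, p₂]] and P̃ = [[2l₁ − l₂p₁, l₂p₂ − l₁p₁/2 − 1], [l₂p₂ − l₁p₁/2 − 1, p₁]] are both positive definite. -/
open Matrix in
theorem posDef_two_aux (a b c : ℝ) (hc : 0 < c) (h : b ^ 2 < a * c) :
    Matrix.PosDef !![a, b; b, c] := by
  refine Matrix.PosDef.of_dotProduct_mulVec_pos ?_ ?_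
  · ext i j
    fin_cases i <;> fin_cases j <;> simp [Matrix.conjTranspose]
  · intro x hx
    have key : 0 < c * (a * x 0 ^ 2 + 2 * b * x 0 * x 1 + c * x 1 ^ 2) := by
      have e : c * (a * x 0 ^ 2 + 2 * b * x 0 * x 1 + c * x 1 ^ 2)
          = (c * x 1 + b * x 0) ^ 2 + (a * c - b ^ 2) * x 0 ^ 2 := by ring
      rw [e]
      have hd : 0 < a * c - b ^ 2 := by linarith
      by_cases h0 : x 0 = 0
      · have h1 : x 1 ≠ 0 := by
          intro h1
          apply hx
          ext i
          fin_cases i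
          · simpa using h0
          · simpa using h1
        rw [h0]
        have : 0 < (c * x 1) ^ 2 := by positivity
        simpa using this
      · positivity
    have k2 := (mul_pos_iff_of_pos_left hc).1 key
    have e2 : star x ⬝ᵥ (!![a, b; b, c]).mulVec x
        = a * x 0 ^ 2 + 2 * b * x 0 * x 1 + c * x 1 ^ 2 := by
      simp [Matrix.mulVec, dotProduct, Fin.sum_univ_two]
      ring
    rw [e2]
    exact k2

/-- Positive definiteness of the Lyapunov matrix `P` and of `P̃ = −(LᵀP + PL)` under
the gain conditions of the paper. -/
theorem lyapunov_matrices_posdef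
    (l₁ l₂ p₁ p₂ : ℝ)
    (hl₁ : 0 < l₁) (hl₂ : 0 < l₂) (hp₁ : 0 < p₁) (hp₂ : 0 < p₂)
    (h1 : (2 + l₁ * p₁ - 2 * l₂ * p₂) ^ 2 < 8 * l₁ * p₁ - 4 * l₂ * p₁ ^ 2)
    (h2 : p₁ ^ 2 < 4 * p₂) :
    Matrix.PosDef !![(1 : ℝ), -p₁ / 2; -p₁ / 2, p₂] ∧
    Matrix.PosDef !![2 * l₁ - l₂ * p₁, l₂ * p₂ - l₁ * p₁ / 2 - 1;
                     l₂ * p₂ - l₁ * p₁ / 2 - 1, p₁] := by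
  exact ⟨posDef_two_aux _ _ _ hp₂ (by nlinarith), posDef_two_aux _ _ _ hp₁ (by nlinarith)⟩
end

section
/- Let l₁, l₂, p₁, p₂ > 0 satisfy (2 + l₁p₁ − 2l₂p₂)² < 8l₁p₁ − 4l₂p₁² and p₁² < 4p₂. Let δ : [0,∞) → ℝ be continuous and let e = (e₁, e₂) : [0,∞) → ℝ² be differentiable with e₁'(t) = −l₁e₁(t) + e₂(t) + l₁δ(t) and e₂'(t) = −l₂e₁(t) + l₂δ(t) for all t ≥ 0. Define J(e) := e₁² − p₁e₁e₂ + p₂e₂². Then there exist positive constants K₁, K₂, β₁, β₂ > 0 such that for all t ≥ 0: K₁·|e(t)|² ≤ J(e(t)) ≤ K₂·|e(t)|², and (d/dt) J(e(t)) ≤ −2β₁·J(e(t)) + β₂·|δ(t)|². -/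
theorem quad_lower (a b c : ℝ) (ha : 0 < a) (hc : 0 < c) (h : b ^ 2 < 4 * a * c) :
    ∃ k : ℝ, 0 < k ∧ ∀ x y : ℝ, k * (x ^ 2 + y ^ 2) ≤ a * x ^ 2 + b * x * y + c * y ^ 2 := by
  obtain ⟨k, hk⟩ : ∃ k : ℝ, k = (4 * a * c - b ^ 2) / (4 * (a + c)) := ⟨_, rfl⟩
  have hk0 : 0 < k := by
    rw [hk]; apply div_pos <;> linarith
  have hk1 : k * (4 * (a + c)) = 4 * a * c - b ^ 2 := by
    rw [hk]; field_simp
  refine ⟨k, hk0, fun x y => ?_⟩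
  have hak : 0 < a - k := by
    by_contra hcon
    have : a * (4 * (a + c)) ≤ k * (4 * (a + c)) :=
      mul_le_mul_of_nonneg_right (by linarith) (by linarith)
    nlinarith [sq_nonneg b, mul_pos ha ha]
  have hm : 0 ≤ 4 * (a - k) * ((a - k) * x ^ 2 + b * x * y + (c - k) * y ^ 2) := by
    have e : 4 * (a - k) * ((a - k) * x ^ 2 + b * x * y + (c - k) * y ^ 2)
        = (2 * (a - k) * x + b * y) ^ 2 + 4 * k ^ 2 * y ^ 2 := by
      linear_combination (-y ^ 2) * hk1
    rw [e]; positivity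
  have := nonneg_of_mul_nonneg_right hm (by linarith)
  linarith

/-- Lemma 2 (stability of observer dynamics): the quadratic form
`J(e) = e₁² − p₁e₁e₂ + p₂e₂²` is equivalent to the squared Euclidean norm and satisfies
`(d/dt) J(e(t)) ≤ −2β₁ J(e(t)) + β₂ δ(t)²` along the observer error dynamics. -/
theorem observer_dynamics_stability
    (l₁ l₂ p₁ p₂ : ℝ)
    (hl₁ : 0 < l₁) (hl₂ : 0 < l₂) (hp₁ : 0 < p₁) (hp₂ : 0 < p₂)
    (h1 : (2 + l₁ * p₁ - 2 * l₂ * p₂) ^ 2 < 8 * l₁ * p₁ - 4 * l₂ * p₁ ^ 2)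
    (h2 : p₁ ^ 2 < 4 * p₂)
    (δ e₁ e₂ : ℝ → ℝ)
    (hδc : ContinuousOn δ (Set.Ici 0))
    (he₁ : ∀ t, 0 ≤ t → HasDerivAt e₁ (-l₁ * e₁ t + e₂ t + l₁ * δ t) t)
    (he₂ : ∀ t, 0 ≤ t → HasDerivAt e₂ (-l₂ * e₁ t + l₂ * δ t) t) :
    ∃ K₁ K₂ β₁ β₂ : ℝ, 0 < K₁ ∧ 0 < K₂ ∧ 0 < β₁ ∧ 0 < β₂ ∧
      ∀ t, 0 ≤ t →
        K₁ * ((e₁ t) ^ 2 + (e₂ t) ^ 2) ≤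
            (e₁ t) ^ 2 - p₁ * e₁ t * e₂ t + p₂ * (e₂ t) ^ 2 ∧
        (e₁ t) ^ 2 - p₁ * e₁ t * e₂ t + p₂ * (e₂ t) ^ 2 ≤
            K₂ * ((e₁ t) ^ 2 + (e₂ t) ^ 2) ∧
        deriv (fun τ => (e₁ τ) ^ 2 - p₁ * e₁ τ * e₂ τ + p₂ * (e₂ τ) ^ 2) t ≤
          -2 * β₁ * ((e₁ t) ^ 2 - p₁ * e₁ t * e₂ t + p₂ * (e₂ t) ^ 2) + β₂ * (δ t) ^ 2 := by
  obtain ⟨K₁, hK₁, HK₁⟩ := quad_lower 1 (-p₁) p₂ one_pos hp₂ (by linarith [neg_sq p₁])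
  have ha : 0 < 2 * l₁ - l₂ * p₁ := by
    by_contra hcon
    nlinarith [sq_nonneg (2 + l₁ * p₁ - 2 * l₂ * p₂)]
  obtain ⟨k, hk, Hk⟩ := quad_lower (2 * l₁ - l₂ * p₁) (-(2 + l₁ * p₁ - 2 * l₂ * p₂)) p₁ ha hp₁
    (by rw [neg_sq]; linarith)
  have hK : 0 < 1 + p₁ + p₂ := by linarith
  obtain ⟨A, hA⟩ : ∃ A : ℝ, A = 2 * l₁ - p₁ * l₂ := ⟨_, rfl⟩
  obtain ⟨B, hB⟩ : ∃ B : ℝ, B = 2 * p₂ * l₂ - p₁ * l₁ := ⟨_, rfl⟩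
  refine ⟨K₁, 1 + p₁ + p₂, k / (4 * (1 + p₁ + p₂)), (A ^ 2 + B ^ 2) / (2 * k) + 1, hK₁, hK,
    by positivity, by positivity, fun t ht => ?_⟩
  have d1 := he₁ t ht
  have d2 := he₂ t ht
  have d := (((d1.pow 2).sub ((d1.const_mul p₁).mul d2)).add ((d2.pow 2).const_mul p₂)).deriv
  have d' : deriv (fun τ => (e₁ τ) ^ 2 - p₁ * e₁ τ * e₂ τ + p₂ * (e₂ τ) ^ 2) t = _ := d
  rw [d']
  clear d d' d1 d2 he₁ he₂
  generalize e₁ t = x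
  generalize e₂ t = y
  generalize δ t = w
  have hup : x ^ 2 - p₁ * x * y + p₂ * y ^ 2 ≤ (1 + p₁ + p₂) * (x ^ 2 + y ^ 2) := by
    nlinarith [mul_nonneg hp₁.le (sq_nonneg (x + y)), mul_nonneg hp₁.le (sq_nonneg x),
      mul_nonneg hp₁.le (sq_nonneg y), mul_nonneg hp₂.le (sq_nonneg x), sq_nonneg y]
  refine ⟨by linarith [HK₁ x y], hup, ?_⟩
  have hJ : k / (2 * (1 + p₁ + p₂)) * (x ^ 2 - p₁ * x * y + p₂ * y ^ 2)
      ≤ k / 2 * (x ^ 2 + y ^ 2) := by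
    calc _ ≤ k / (2 * (1 + p₁ + p₂)) * ((1 + p₁ + p₂) * (x ^ 2 + y ^ 2)) :=
          mul_le_mul_of_nonneg_left hup (by positivity)
      _ = _ := by field_simp
  have hw : w * (A * x + B * y) ≤ k / 2 * (x ^ 2 + y ^ 2) + (A ^ 2 + B ^ 2) / (2 * k) * w ^ 2 := by
    have e : k / 2 * (x ^ 2 + y ^ 2) + (A ^ 2 + B ^ 2) / (2 * k) * w ^ 2 - w * (A * x + B * y)
        = ((k * x - A * w) ^ 2 + (k * y - B * w) ^ 2) / (2 * k) := by
      field_simp; ring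
    have : 0 ≤ ((k * x - A * w) ^ 2 + (k * y - B * w) ^ 2) / (2 * k) := by positivity
    linarith
  have hb : -2 * (k / (4 * (1 + p₁ + p₂))) = -(k / (2 * (1 + p₁ + p₂))) := by
    field_simp; norm_num
  rw [hb]
  have h3 := Hk x y
  have hAB : w * (A * x + B * y)
      = w * ((2 * l₁ - p₁ * l₂) * x + (2 * p₂ * l₂ - p₁ * l₁) * y) := by rw [hA, hB]
  norm_num
  nlinarith [sq_nonneg w]
end

section
/- For all real numbers a, b > 0 and all z ∈ ℝ, the inequality z · sat_{[−a,b]}(z) ≥ min(1, a, b) · z² / (1 + |z|) holds, where sat_{[−a,b]}(z) := min(b, max(−a, z)). -/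
/-- The Fact of Appendix A: for `a, b > 0` and all `z ∈ ℝ`,
`z · sat_{[−a,b]}(z) ≥ min(1,a,b) · z²/(1+|z|)`, where
`sat_{[−a,b]}(z) = min(b, max(−a, z))`. -/
theorem saturation_fact (a b z : ℝ) (ha : 0 < a) (hb : 0 < b) :
    min 1 (min a b) * z ^ 2 / (1 + |z|) ≤ z * min b (max (-a) z) := by
  obtain ⟨m, hm⟩ : ∃ m, m = min 1 (min a b) := ⟨_, rfl⟩
  have h1 : m ≤ 1 := hm ▸ min_le_left _ _
  have h2 : m ≤ a := hm ▸ (min_le_right _ _).trans (min_le_left _ _)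
  have h3 : m ≤ b := hm ▸ (min_le_right _ _).trans (min_le_right _ _)
  rw [← hm, div_le_iff₀ (by positivity)]
  rcases le_total 0 z with hz | hz
  · rw [abs_of_nonneg hz, max_eq_right (by linarith)]
    rcases le_total b z with h | h
    · rw [min_eq_left h]
      nlinarith [mul_nonneg (sub_nonneg.2 h3) (sq_nonneg z), mul_nonneg hz hb.le]
    · rw [min_eq_right h]
      nlinarith [mul_nonneg (sub_nonneg.2 h1) (sq_nonneg z), mul_nonneg hz (sq_nonneg z)]
  · rw [abs_of_nonpos hz, min_eq_right (max_le (by linarith) (by linarith))]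
    have hz' : 0 ≤ -z := by linarith
    rcases le_total (-a) z with h | h
    · rw [max_eq_right h]
      nlinarith [mul_nonneg (sub_nonneg.2 h1) (sq_nonneg z), mul_nonneg hz' (sq_nonneg z)]
    · rw [max_eq_left h]
      nlinarith [mul_nonneg (sub_nonneg.2 h2) (sq_nonneg z), mul_nonneg hz' ha.le]
end

section
/- Let γ > 0 and a, b > 0. Then for all η, w ∈ ℝ: 2η · sat_{[−a,b]}(w + γη) ≥ 2η · sat_{[−a,b]}(γη/2) − (8/γ) · max(a, b) · |w|, where sat_{[−a,b]}(z) := min(b, max(−a, z)). -/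
/-- Pointwise saturation inequality used in the proof of Lemma 3:
`2η·sat_{[−a,b]}(w + γη) ≥ 2η·sat_{[−a,b]}(γη/2) − (8/γ)·max(a,b)·|w|`. -/
theorem saturation_shift_inequality
    (γ a b : ℝ) (hγ : 0 < γ) (ha : 0 < a) (hb : 0 < b) (η w : ℝ) :
    2 * η * min b (max (-a) (γ * η / 2)) - (8 / γ) * max a b * |w| ≤
      2 * η * min b (max (-a) (w + γ * η)) := by
  have hM : 0 < max a b := lt_max_of_lt_left ha
  have hbd : ∀ z : ℝ, |min b (max (-a) z)| ≤ max a b := by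
    intro z
    rw [abs_le]
    constructor
    · have h1 : -a ≤ min b (max (-a) z) := le_min (by linarith) (le_max_left _ _)
      have h2 := le_max_left a b
      linarith
    · exact (min_le_left _ _).trans (le_max_right a b)
  have hmono : ∀ x y : ℝ, x ≤ y → min b (max (-a) x) ≤ min b (max (-a) y) :=
    fun x y h => min_le_min le_rfl (max_le_max le_rfl h)
  have hpos : 0 ≤ (8 / γ) * max a b * |w| := by positivity
  rcases lt_or_ge (γ * |η| / 2) |w| with h | h
  · have hη : 4 * |η| * max a b ≤ (8 / γ) * max a b * |w| := by
      have : |η| ≤ 2 / γ * |w| := by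
        rw [div_mul_eq_mul_div, le_div_iff₀ hγ]; linarith
      calc 4 * |η| * max a b ≤ 4 * (2 / γ * |w|) * max a b := by gcongr
        _ = _ := by ring
    have h1 : |η * min b (max (-a) (γ * η / 2))| ≤ |η| * max a b := by
      rw [abs_mul]; exact mul_le_mul_of_nonneg_left (hbd _) (abs_nonneg _)
    have h2 : |η * min b (max (-a) (w + γ * η))| ≤ |η| * max a b := by
      rw [abs_mul]; exact mul_le_mul_of_nonneg_left (hbd _) (abs_nonneg _)
    have h3 := (abs_le.mp h1).2
    have h4 := (abs_le.mp h2).1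
    linarith
  · have hw := abs_le.mp h
    rcases le_total 0 η with h0 | h0
    · rw [abs_of_nonneg h0] at hw
      have := mul_le_mul_of_nonneg_left (hmono (γ * η / 2) (w + γ * η) (by linarith [hw.1])) h0
      linarith
    · rw [abs_of_nonpos h0] at hw
      have := mul_le_mul_of_nonpos_left (hmono (w + γ * η) (γ * η / 2) (by linarith [hw.2])) h0
      linarith
end

section
/- Let D_min < D* < D_max, γ > 0, and let y_ref : [0,∞) → (0,∞) be continuously differentiable with D* − D_max < inf_{t≥0} y_ref'(t)/y_ref(t) ≤ sup_{t≥0} y_ref'(t)/y_ref(t) < D* − D_min. Let e₂, δ : [0,∞) → ℝ be continuous and let η : [0,∞) → ℝ be differentiable with η'(t) = D* − y_ref'(t)/y_ref(t) − sat_{[D_min,D_max]}(D* + e₂(t) − y_ref'(t)/y_ref(t) + γη(t) + γδ(t)) for all t ≥ 0. Define μ₂ := (8/γ)(D_max − D_min) and μ₁ := min(2,γ) · min{1, D* − D_min − sup_{τ≥0} y_ref'(τ)/y_ref(τ), D_max − D* + inf_{τ≥0} y_ref'(τ)/y_ref(τ)}. Then μ₁ > 0 and for all t ≥ 0: (d/dt)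 η²(t) ≤ −μ₁ · η²(t)/(1 + |η(t)|) + μ₂ · |e₂(t) + γδ(t)|. -/
lemma core_nonneg (A B m γ x w : ℝ) (hm : 0 < m) (hm1 : m ≤ 1) (hA : m ≤ A) (hB : m ≤ B)
    (hγ : 0 < γ) (hx : 0 ≤ x) :
    -(2 * x * min B (max (-A) (γ * x + w))) ≤
      -(min 2 γ * m) * x ^ 2 / (1 + x) + 8 / γ * (A + B) * |w| := by
  have hq0 : 0 ≤ x ^ 2 / (1 + x) := by positivity
  have hq1 : x ^ 2 / (1 + x) ≤ x := by
    rw [div_le_iff₀ (by positivity)]; nlinarith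
  have hq2 : x ^ 2 / (1 + x) ≤ x ^ 2 := by
    apply div_le_self <;> nlinarith
  have e : -(min 2 γ * m) * x ^ 2 / (1 + x) = -(min 2 γ * (m * (x ^ 2 / (1 + x)))) := by ring
  rw [e]
  set q := x ^ 2 / (1 + x) with hq
  have h2 : min 2 γ * (m * q) ≤ 2 * (m * q) :=
    mul_le_mul_of_nonneg_right (min_le_left _ _) (by positivity)
  have h3 : min 2 γ * (m * q) ≤ γ * (m * q) :=
    mul_le_mul_of_nonneg_right (min_le_right _ _) (by positivity)
  have hmq1 : m * q ≤ m * x := mul_le_mul_of_nonneg_left hq1 hm.le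
  have hmq2 : m * q ≤ x ^ 2 := by nlinarith
  have hAB : 0 < A + B := by linarith
  by_cases hw : |w| ≤ γ * x / 2
  · have hw' := neg_abs_le w
    have hR : 0 ≤ 8 / γ * (A + B) * |w| := by positivity
    have hφ : min m (γ * x / 2) ≤ min B (max (-A) (γ * x + w)) := by
      apply min_le_min hB
      exact le_trans (by linarith) (le_max_right _ _)
    have h4 : x * min m (γ * x / 2) ≤ x * min B (max (-A) (γ * x + w)) :=
      mul_le_mul_of_nonneg_left hφ hx
    rcases min_choice m (γ * x / 2) with h | h <;> rw [h] at h4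
    · nlinarith
    · have := mul_le_mul_of_nonneg_left hmq2 hγ.le
      nlinarith
  · push Not at hw
    have hx2 : x ≤ 2 / γ * |w| := by
      rw [div_mul_eq_mul_div, le_div_iff₀ hγ]; linarith
    have hφ : -(A + B) ≤ min B (max (-A) (γ * x + w)) :=
      le_min (by linarith) (le_trans (by linarith) (le_max_left _ _))
    have h4 := mul_le_mul_of_nonneg_left hφ hx
    have h5 := mul_le_mul_of_nonneg_left hx2 hAB.le
    have h6 : 8 / γ * (A + B) * |w| = 4 * ((A + B) * (2 / γ * |w|)) := by ring
    rw [h6]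
    have h7 : m * x ≤ (A + B) * x := mul_le_mul_of_nonneg_right (by linarith) hx
    nlinarith

lemma core_all (A B m γ x w : ℝ) (hm : 0 < m) (hm1 : m ≤ 1) (hA : m ≤ A) (hB : m ≤ B)
    (hγ : 0 < γ) :
    -(2 * x * min B (max (-A) (γ * x + w))) ≤
      -(min 2 γ * m) * x ^ 2 / (1 + |x|) + 8 / γ * (A + B) * |w| := by
  rcases le_total 0 x with hx | hx
  · rw [abs_of_nonneg hx]; exact core_nonneg A B m γ x w hm hm1 hA hB hγ hx
  · have h := core_nonneg B A m γ (-x) (-w) hm hm1 hB hA hγ (by linarith)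
    have e : min A (max (-B) (γ * -x + -w)) = -min B (max (-A) (γ * x + w)) := by
      rw [show γ * -x + -w = -(γ * x + w) by ring]
      generalize γ * x + w = s
      have hAB : 0 < A + B := by linarith
      grind
    rw [e, abs_neg, neg_sq] at h
    rw [abs_of_nonpos hx]
    linarith


/-- Lemma 3 (stability of scalar dynamics): along the saturated closed-loop dynamics of
the scalar state `η`, the estimate
`(d/dt) η²(t) ≤ −μ₁ η²(t)/(1+|η(t)|) + μ₂ |e₂(t) + γδ(t)|` holds with `μ₁ > 0`. -/
theorem scalar_dynamics_stability
    (Dmin Dmax Dstar γ : ℝ)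
    (hDmin : Dmin < Dstar) (hDmax : Dstar < Dmax) (hγ : 0 < γ)
    (yref : ℝ → ℝ) (hypos : ∀ t, 0 ≤ t → 0 < yref t)
    (hyd : ∀ t, 0 ≤ t → DifferentiableAt ℝ yref t)
    (hydc : ContinuousOn (deriv yref) (Set.Ici 0))
    (hbddA : BddAbove ((fun t => deriv yref t / yref t) '' Set.Ici 0))
    (hbddB : BddBelow ((fun t => deriv yref t / yref t) '' Set.Ici 0))
    (hinf : Dstar - Dmax < sInf ((fun t => deriv yref t / yref t) '' Set.Ici 0))
    (hsup : sSup ((fun t => deriv yref t / yref t) '' Set.Ici 0) < Dstar - Dmin)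
    (e₂ δ : ℝ → ℝ)
    (he₂c : ContinuousOn e₂ (Set.Ici 0)) (hδc : ContinuousOn δ (Set.Ici 0))
    (η : ℝ → ℝ)
    (hη : ∀ t, 0 ≤ t → HasDerivAt η
      (Dstar - deriv yref t / yref t -
        min Dmax (max Dmin
          (Dstar + e₂ t - deriv yref t / yref t + γ * η t + γ * δ t))) t)
    (μ₁ μ₂ : ℝ)
    (hμ₂ : μ₂ = (8 / γ) * (Dmax - Dmin))
    (hμ₁ : μ₁ = min 2 γ * min 1 (min
      (Dstar - Dmin - sSup ((fun t => deriv yref t / yref t) '' Set.Ici 0))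
      (Dmax - Dstar + sInf ((fun t => deriv yref t / yref t) '' Set.Ici 0)))) :
    0 < μ₁ ∧ ∀ t, 0 ≤ t →
      deriv (fun τ => (η τ) ^ 2) t ≤
        -μ₁ * (η t) ^ 2 / (1 + |η t|) + μ₂ * |e₂ t + γ * δ t| := by
  set S := (fun t => deriv yref t / yref t) '' Set.Ici 0 with hS
  set m := min 1 (min (Dstar - Dmin - sSup S) (Dmax - Dstar + sInf S)) with hm
  have hm0 : 0 < m := lt_min one_pos (lt_min (by linarith) (by linarith))
  have hm1 : m ≤ 1 := min_le_left _ _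
  have hmA : m ≤ Dstar - Dmin - sSup S := (min_le_right _ _).trans (min_le_left _ _)
  have hmB : m ≤ Dmax - Dstar + sInf S := (min_le_right _ _).trans (min_le_right _ _)
  refine ⟨by rw [hμ₁]; exact mul_pos (lt_min two_pos hγ) hm0, fun t ht => ?_⟩
  have hmem : deriv yref t / yref t ∈ S := ⟨t, ht, rfl⟩
  have h1 := le_csSup hbddA hmem
  have h2 := csInf_le hbddB hmem
  have hd := ((hη t ht).pow 2).deriv
  have hd' : deriv (fun τ => (η τ) ^ 2) t = _ := hd
  rw [hd', hμ₁, hμ₂]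
  generalize deriv yref t / yref t = r at *
  have h := core_all (Dstar - r - Dmin) (Dmax - (Dstar - r)) m γ (η t) (e₂ t + γ * δ t)
    hm0 hm1 (by linarith) (by linarith) hγ
  have e : min (Dmax - (Dstar - r)) (max (-(Dstar - r - Dmin)) (γ * η t + (e₂ t + γ * δ t)))
      = min Dmax (max Dmin (Dstar + e₂ t - r + γ * η t + γ * δ t)) - (Dstar - r) := by
    rw [← min_sub_sub_right, ← max_sub_sub_right]
    congr 2 <;> ring
  rw [e, show Dstar - r - Dmin + (Dmax - (Dstar - r)) = Dmax - Dmin by ring] at h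
  refine le_trans (le_of_eq ?_) h
  push_cast
  ring
end

section
/- Let A > 0 and let k̃ : [0,A] → ℝ be continuous with ∫₀^A k̃(a) da = 1. Let ψ : [−A,∞) → ℝ be continuous and satisfy the integral delay equation ψ(t) = ∫₀^A k̃(a) ψ(t−a) da for all t ≥ 0. Define w(a) := ∫_a^A k̃(s) ds. Then the function F(t) := ∫₀^A w(a) ψ(t−a) da is constant on [0,∞); in particular, if F(0) = 0 then ∫₀^A w(a) ψ(t−a) da = 0 for all t ≥ 0. -/
theorem ide_aux (A : ℝ) (k ψ : ℝ → ℝ) (hk : Continuous k) (hψ : Continuous ψ)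
    (hnorm : ∫ a in (0:ℝ)..A, k a = 1)
    (hIDE : ∀ t, 0 ≤ t → ψ t = ∫ a in (0:ℝ)..A, k a * ψ (t - a)) (t : ℝ) (ht : 0 ≤ t) :
    (∫ a in (0:ℝ)..A, (∫ s in a..A, k s) * ψ (t - a)) =
      ∫ a in (0:ℝ)..A, (∫ s in a..A, k s) * ψ (0 - a) := by
  set P : ℝ → ℝ := fun x => ∫ s in (0:ℝ)..x, ψ s with hP
  have hPd : ∀ x, HasDerivAt P (ψ x) x := fun x =>
    intervalIntegral.integral_hasDerivAt_right (hψ.intervalIntegrable _ _)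
      (hψ.stronglyMeasurableAtFilter _ _) hψ.continuousAt
  have hPc : Continuous P := continuous_iff_continuousAt.2 fun x => (hPd x).continuousAt
  have hwd : ∀ x, HasDerivAt (fun a => ∫ s in a..A, k s) (-k x) x := fun x =>
    intervalIntegral.integral_hasDerivAt_left (hk.intervalIntegrable _ _)
      (hk.stronglyMeasurableAtFilter _ _) hk.continuousAt
  have key : ∀ t, (∫ a in (0:ℝ)..A, (∫ s in a..A, k s) * ψ (t - a)) =
      P t - ∫ a in (0:ℝ)..A, k a * P (t - a) := by
    intro t
    have hv : ∀ x, HasDerivAt (fun a => -P (t - a)) (ψ (t - x)) x := by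
      intro x
      have h := ((hPd (t - x)).comp_const_sub t x).neg
      rw [neg_neg] at h
      exact h
    rw [intervalIntegral.integral_mul_deriv_eq_deriv_mul (fun x _ => hwd x) (fun x _ => hv x)
      (hk.neg.intervalIntegrable _ _) ((hψ.comp (by fun_prop)).intervalIntegrable _ _)]
    simp [hnorm]
  have swap : (∫ a in (0:ℝ)..A, k a * P (t - a)) - (∫ a in (0:ℝ)..A, k a * P (0 - a)) = P t := by
    rw [← intervalIntegral.integral_sub
      (Continuous.intervalIntegrable (by fun_prop) _ _)
      (Continuous.intervalIntegrable (by fun_prop) _ _)]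
    have e : ∀ a, k a * P (t - a) - k a * P (0 - a) = ∫ s in (0:ℝ)..t, k a * ψ (s - a) := by
      intro a
      rw [intervalIntegral.integral_const_mul, intervalIntegral.integral_comp_sub_right, ← mul_sub]
      congr 1
      exact intervalIntegral.integral_interval_sub_left (hψ.intervalIntegrable _ _)
        (hψ.intervalIntegrable _ _)
    simp_rw [e]
    rw [MeasureTheory.intervalIntegral_intervalIntegral_swap]
    · apply intervalIntegral.integral_congr
      intro s hs
      rw [Set.uIcc_of_le ht] at hs
      exact (hIDE s hs.1).symm
    · have hc : Continuous (Function.uncurry fun a s => k a * ψ (s - a)) := by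
        unfold Function.uncurry
        fun_prop
      exact (hc.continuousOn.integrableOn_compact (isCompact_uIcc.prod isCompact_uIcc)).mono_set
        (Set.prod_mono Set.uIoc_subset_uIcc Set.uIoc_subset_uIcc)
  have h0 : P 0 = 0 := by simp [hP]
  rw [key, key, h0]
  linarith

/-- The functional `F(t) = ∫₀^A w(a) ψ(t−a) da` with `w(a) = ∫_a^A k̃(s) ds` is a
conserved quantity of the integral delay equation `ψ(t) = ∫₀^A k̃(a) ψ(t−a) da`;
in particular it vanishes identically if it vanishes initially. -/
theorem ide_conserved_functional
    (A : ℝ) (hA : 0 < A)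
    (ktil : ℝ → ℝ) (hkc : ContinuousOn ktil (Set.Icc 0 A))
    (hnorm : ∫ a in (0:ℝ)..A, ktil a = 1)
    (ψ : ℝ → ℝ) (hψc : ContinuousOn ψ (Set.Ici (-A)))
    (hIDE : ∀ t, 0 ≤ t → ψ t = ∫ a in (0:ℝ)..A, ktil a * ψ (t - a))
    (w : ℝ → ℝ) (hw : ∀ a, w a = ∫ s in a..A, ktil s) :
    (∀ t, 0 ≤ t →
      (∫ a in (0:ℝ)..A, w a * ψ (t - a)) = ∫ a in (0:ℝ)..A, w a * ψ (0 - a)) ∧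
    ((∫ a in (0:ℝ)..A, w a * ψ (0 - a)) = 0 →
      ∀ t, 0 ≤ t → (∫ a in (0:ℝ)..A, w a * ψ (t - a)) = 0) := by
  have main : ∀ t, 0 ≤ t →
      (∫ a in (0:ℝ)..A, w a * ψ (t - a)) = ∫ a in (0:ℝ)..A, w a * ψ (0 - a) := by
    set k' : ℝ → ℝ := fun x => ktil (max 0 (min x A)) with hk'
    set ψ' : ℝ → ℝ := fun x => ψ (max x (-A)) with hψ'
    have ck : Continuous k' := hkc.comp_continuous (by fun_prop)
      fun x => ⟨le_max_left _ _, max_le hA.le (min_le_right _ _)⟩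
    have cψ : Continuous ψ' := hψc.comp_continuous (by fun_prop) fun x =>
      Set.mem_Ici.2 (le_max_right _ _)
    have ek : ∀ x ∈ Set.Icc 0 A, k' x = ktil x := by
      intro x hx
      simp [hk', min_eq_left hx.2, max_eq_right hx.1]
    have eψ : ∀ x, -A ≤ x → ψ' x = ψ x := by
      intro x hx
      simp [hψ', max_eq_left hx]
    have ew : ∀ a ∈ Set.Icc 0 A, (∫ s in a..A, k' s) = w a := by
      intro a ha
      rw [hw]
      apply intervalIntegral.integral_congr
      intro s hs
      rw [Set.uIcc_of_le ha.2] at hs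
      exact ek s ⟨ha.1.trans hs.1, hs.2⟩
    have eF : ∀ t, 0 ≤ t → (∫ a in (0:ℝ)..A, (∫ s in a..A, k' s) * ψ' (t - a)) =
        ∫ a in (0:ℝ)..A, w a * ψ (t - a) := by
      intro t ht
      apply intervalIntegral.integral_congr
      intro a ha
      rw [Set.uIcc_of_le hA.le] at ha
      simp only [ew a ha, eψ (t - a) (by linarith [ha.2])]
    intro t ht
    rw [← eF t ht, ← eF 0 le_rfl]
    refine ide_aux A k' ψ' ck cψ ?_ ?_ t ht
    · rw [← hnorm]
      apply intervalIntegral.integral_congr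
      intro a ha
      rw [Set.uIcc_of_le hA.le] at ha
      exact ek a ha
    · intro t ht
      rw [eψ t (by linarith), hIDE t ht]
      apply intervalIntegral.integral_congr
      intro a ha
      rw [Set.uIcc_of_le hA.le] at ha
      simp only [ek a ha, eψ (t - a) (by linarith [ha.2])]
  exact ⟨main, fun h t ht => (main t ht).trans h⟩
end
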